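/- Let h_min > 0 and M ≥ 1. There exists a constant C > 0, depending only on h_min and M, such that for all ε, μ ∈ (0,1], all smooth h, b : ℝ² → ℝ with h(X) ≥ h_min and |∇b(X)| ≤ M for all X, and all smooth compactly supported v : ℝ² → ℝ², one has |v|₂² + μ |∇·v|₂² + μ |curl v|₂² ≤ C ∫_{ℝ²} (𝔗v)·v, where |·|₂ denotes the L²(ℝ²) norm. -/

import Mathlib

open MeasureTheory

noncomputable section

/-- Partial derivative in the first coordinate direction. -/
def pd1 (f : ℝ × ℝ → ℝ) (x : ℝ × ℝ) : ℝ := fderiv ℝ f x (1, 0)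

/-- Partial derivative in the second coordinate direction. -/
def pd2 (f : ℝ × ℝ → ℝ) (x : ℝ × ℝ) : ℝ := fderiv ℝ f x (0, 1)

/-- Gradient of a scalar function on `ℝ²`. -/
def grad (f : ℝ × ℝ → ℝ) (x : ℝ × ℝ) : ℝ × ℝ := (pd1 f x, pd2 f x)

/-- Euclidean dot product on `ℝ²`. -/
def dot (a b : ℝ × ℝ) : ℝ := a.1 * b.1 + a.2 * b.2

/-- Divergence of a vector field on `ℝ²`. -/
def divg (W : ℝ × ℝ → ℝ × ℝ) (x : ℝ × ℝ) : ℝ :=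
  pd1 (fun y => (W y).1) x + pd2 (fun y => (W y).2) x

/-- Scalar curl of a vector field on `ℝ²`: `curl W = ∂₁W₂ - ∂₂W₁`. -/
def curl (W : ℝ × ℝ → ℝ × ℝ) (x : ℝ × ℝ) : ℝ :=
  pd1 (fun y => (W y).2) x - pd2 (fun y => (W y).1) x

/-- `∇⊥ f = (-∂₂ f, ∂₁ f)`. -/
def gradPerp (f : ℝ × ℝ → ℝ) (x : ℝ × ℝ) : ℝ × ℝ := (-(pd2 f x), pd1 f x)

/-- The Green–Naghdi operator `𝒯[h, εb]`. -/
def Tcal (ε : ℝ) (h b : ℝ × ℝ → ℝ) (W : ℝ × ℝ → ℝ × ℝ) (x : ℝ × ℝ) : ℝ × ℝ :=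
  (-(1/3 : ℝ)) • grad (fun y => (h y)^3 * divg W y) x
    + (ε/2) • (grad (fun y => (h y)^2 * dot (grad b y) (W y)) x
        - ((h x)^2 * divg W x) • grad b x)
    + (ε^2 * h x * dot (grad b x) (W x)) • grad b x

/-- The operator `𝔗 = h + μ(𝒯[h,εb] - ∇⊥ curl)`. -/
def Tfrak (ε μ : ℝ) (h b : ℝ × ℝ → ℝ) (W : ℝ × ℝ → ℝ × ℝ) (x : ℝ × ℝ) : ℝ × ℝ :=
  h x • W x + μ • (Tcal ε h b W x - gradPerp (curl W) x)

theorem ContDiff.pd1 {f : ℝ × ℝ → ℝ} (hf : ContDiff ℝ (⊤ : ℕ∞) f) :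
    ContDiff ℝ (⊤ : ℕ∞) (pd1 f) :=
  (hf.fderiv_right (by simp)).clm_apply contDiff_const

theorem ContDiff.pd2 {f : ℝ × ℝ → ℝ} (hf : ContDiff ℝ (⊤ : ℕ∞) f) :
    ContDiff ℝ (⊤ : ℕ∞) (pd2 f) :=
  (hf.fderiv_right (by simp)).clm_apply contDiff_const

theorem integral_fderiv_apply_eq_zero {f : ℝ × ℝ → ℝ} (hf : ContDiff ℝ (⊤ : ℕ∞) f)
    (hc : HasCompactSupport f) (w : ℝ × ℝ) :
    Integrable (fun x => fderiv ℝ f x w) ∧ ∫ x, fderiv ℝ f x w = 0 := by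
  have hcont : Continuous (fun x => fderiv ℝ f x w) :=
    (hf.continuous_fderiv (by simp)).clm_apply continuous_const
  have hint : Integrable (fun x => fderiv ℝ f x w) :=
    hcont.integrable_of_hasCompactSupport (hc.fderiv_apply (𝕜 := ℝ) w)
  refine ⟨hint, ?_⟩
  have hparts := integral_mul_fderiv_eq_neg_fderiv_mul_of_integrable (𝕜 := ℝ)
    (μ := (volume : Measure (ℝ × ℝ))) (f := fun _ => (1 : ℝ)) (g := f) (v := w)
    (by simp) (by simpa using hint)
    (by simpa using hf.continuous.integrable_of_hasCompactSupport hc)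
    (fun _ _ => differentiableAt_const _)
    (fun x _ => (hf.differentiable (by simp)) x)
  simpa using hparts

/-- The density obtained from `(𝔗v)·v` after integration by parts. -/
def energyDensity (ε μ : ℝ) (h b : ℝ × ℝ → ℝ) (v : ℝ × ℝ → ℝ × ℝ) (x : ℝ × ℝ) : ℝ :=
  h x * dot (v x) (v x) + μ * ((1/3) * (h x)^3 * (divg v x)^2
    - ε * (h x)^2 * dot (grad b x) (v x) * divg v x
    + ε^2 * h x * (dot (grad b x) (v x))^2 + (curl v x)^2)

/-- The scalar potential whose gradient makes up the second-order part of `𝒯[h, εb]`. -/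
def potential (ε : ℝ) (h b : ℝ × ℝ → ℝ) (v : ℝ × ℝ → ℝ × ℝ) (x : ℝ × ℝ) : ℝ :=
  -(1/3) * ((h x)^3 * divg v x) + (ε/2) * ((h x)^2 * dot (grad b x) (v x))

/-- The flux whose divergence is the difference between `(𝔗v)·v` and `energyDensity`. -/
def energyFlux (ε μ : ℝ) (h b : ℝ × ℝ → ℝ) (v : ℝ × ℝ → ℝ × ℝ) (x : ℝ × ℝ) : ℝ × ℝ :=
  (μ * (potential ε h b v x * (v x).1 - curl v x * (v x).2),
    μ * (potential ε h b v x * (v x).2 + curl v x * (v x).1))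

section Smooth

variable {ε μ : ℝ} {h b : ℝ × ℝ → ℝ} {v : ℝ × ℝ → ℝ × ℝ}

theorem ContDiff.divg (hv : ContDiff ℝ (⊤ : ℕ∞) v) : ContDiff ℝ (⊤ : ℕ∞) (divg v) :=
  hv.fst.pd1.add hv.snd.pd2

theorem ContDiff.curl (hv : ContDiff ℝ (⊤ : ℕ∞) v) : ContDiff ℝ (⊤ : ℕ∞) (curl v) :=
  hv.snd.pd1.sub hv.fst.pd2

theorem ContDiff.dot_grad (hb : ContDiff ℝ (⊤ : ℕ∞) b) (hv : ContDiff ℝ (⊤ : ℕ∞) v) :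
    ContDiff ℝ (⊤ : ℕ∞) (fun x => dot (grad b x) (v x)) :=
  (hb.pd1.mul hv.fst).add (hb.pd2.mul hv.snd)

theorem contDiff_potential (hh : ContDiff ℝ (⊤ : ℕ∞) h) (hb : ContDiff ℝ (⊤ : ℕ∞) b)
    (hv : ContDiff ℝ (⊤ : ℕ∞) v) : ContDiff ℝ (⊤ : ℕ∞) (potential ε h b v) :=
  (contDiff_const.mul ((hh.pow 3).mul hv.divg)).add
    (contDiff_const.mul ((hh.pow 2).mul (hb.dot_grad hv)))

theorem contDiff_energyFlux (hh : ContDiff ℝ (⊤ : ℕ∞) h) (hb : ContDiff ℝ (⊤ : ℕ∞) b)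
    (hv : ContDiff ℝ (⊤ : ℕ∞) v) : ContDiff ℝ (⊤ : ℕ∞) (energyFlux ε μ h b v) := by
  have hs : ContDiff ℝ (⊤ : ℕ∞) (potential ε h b v) := contDiff_potential hh hb hv
  exact (contDiff_const.mul ((hs.mul hv.fst).sub (hv.curl.mul hv.snd))).prodMk
    (contDiff_const.mul ((hs.mul hv.snd).add (hv.curl.mul hv.fst)))

theorem fderiv_potential (hh : ContDiff ℝ (⊤ : ℕ∞) h) (hb : ContDiff ℝ (⊤ : ℕ∞) b)
    (hv : ContDiff ℝ (⊤ : ℕ∞) v) (x w : ℝ × ℝ) :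
    fderiv ℝ (potential ε h b v) x w =
      -(1/3) * fderiv ℝ (fun y => (h y)^3 * divg v y) x w
        + (ε/2) * fderiv ℝ (fun y => (h y)^2 * dot (grad b y) (v y)) x w := by
  have h1 : DifferentiableAt ℝ (fun y => (h y)^3 * divg v y) x :=
    ((hh.pow 3).mul hv.divg).differentiable (by simp) x
  have h2 : DifferentiableAt ℝ (fun y => (h y)^2 * dot (grad b y) (v y)) x :=
    ((hh.pow 2).mul (hb.dot_grad hv)).differentiable (by simp) x
  have hd := ((h1.hasFDerivAt.const_mul (-(1/3))).add (h2.hasFDerivAt.const_mul (ε/2))).fderiv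
  exact (congrArg (fun L : ℝ × ℝ →L[ℝ] ℝ => L w) hd).trans (by simp)

theorem dot_Tfrak_eq (hh : ContDiff ℝ (⊤ : ℕ∞) h) (hb : ContDiff ℝ (⊤ : ℕ∞) b)
    (hv : ContDiff ℝ (⊤ : ℕ∞) v) (x : ℝ × ℝ) :
    dot (Tfrak ε μ h b v x) (v x) =
      energyDensity ε μ h b v x + divg (energyFlux ε μ h b v) x := by
  have hs : HasFDerivAt (potential ε h b v) _ x :=
    ((contDiff_potential hh hb hv).differentiable (by simp) x).hasFDerivAt
  have hc : HasFDerivAt (curl v) _ x := (hv.curl.differentiable (by simp) x).hasFDerivAt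
  have h1 : HasFDerivAt (fun y => (v y).1) _ x :=
    (hv.fst.differentiable (by simp) x).hasFDerivAt
  have h2 : HasFDerivAt (fun y => (v y).2) _ x :=
    (hv.snd.differentiable (by simp) x).hasFDerivAt
  have hF : pd1 (fun y => (energyFlux ε μ h b v y).1) x = _ :=
    congrArg (fun L : ℝ × ℝ →L[ℝ] ℝ => L (1, 0))
      (((hs.mul h1).sub (hc.mul h2)).const_mul μ).fderiv
  have hG : pd2 (fun y => (energyFlux ε μ h b v y).2) x = _ :=
    congrArg (fun L : ℝ × ℝ →L[ℝ] ℝ => L (0, 1))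
      (((hs.mul h2).add (hc.mul h1)).const_mul μ).fderiv
  rw [divg, hF, hG]
  simp only [add_apply, sub_apply, smul_apply, smul_eq_mul, fderiv_potential hh hb hv]
  simp only [energyDensity, Tfrak, Tcal, dot, grad, gradPerp, potential, divg, curl, pd1, pd2,
    Prod.fst_add, Prod.snd_add, Prod.fst_sub, Prod.snd_sub, Prod.smul_fst, Prod.smul_snd,
    smul_eq_mul]
  ring

theorem fderiv_components_eq_zero {x : ℝ × ℝ} (hx : x ∉ tsupport v) (w : ℝ × ℝ) :
    fderiv ℝ (fun y => (v y).1) x w = 0 ∧ fderiv ℝ (fun y => (v y).2) x w = 0 := by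
  have hev : v =ᶠ[nhds x] 0 := notMem_tsupport_iff_eventuallyEq.mp hx
  have h1 : (fun y => (v y).1) =ᶠ[nhds x] fun _ => 0 := by
    filter_upwards [hev] with y hy; simp [hy]
  have h2 : (fun y => (v y).2) =ᶠ[nhds x] fun _ => 0 := by
    filter_upwards [hev] with y hy; simp [hy]
  simp [h1.fderiv_eq, h2.fderiv_eq]

theorem divg_eq_zero_of_notMem_tsupport {x : ℝ × ℝ} (hx : x ∉ tsupport v) : divg v x = 0 := by
  simp [divg, pd1, pd2, fderiv_components_eq_zero hx]

theorem curl_eq_zero_of_notMem_tsupport {x : ℝ × ℝ} (hx : x ∉ tsupport v) : curl v x = 0 := by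
  simp [curl, pd1, pd2, fderiv_components_eq_zero hx]

theorem integral_divg_eq_zero (hv : ContDiff ℝ (⊤ : ℕ∞) v) (hc : HasCompactSupport v) :
    Integrable (divg v) ∧ ∫ x, divg v x = 0 := by
  obtain ⟨hi1, h1⟩ := integral_fderiv_apply_eq_zero hv.fst
    (hc.comp_left (g := Prod.fst) rfl) (1, 0)
  obtain ⟨hi2, h2⟩ := integral_fderiv_apply_eq_zero hv.snd
    (hc.comp_left (g := Prod.snd) rfl) (0, 1)
  exact ⟨hi1.add hi2, (integral_add hi1 hi2).trans (by rw [h1, h2, add_zero])⟩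

theorem integrable_of_eq_zero_off_tsupport (hc : HasCompactSupport v) {f : ℝ × ℝ → ℝ}
    (hf : Continuous f) (h0 : ∀ x, x ∉ tsupport v → f x = 0) : Integrable f :=
  hf.integrable_of_hasCompactSupport (HasCompactSupport.intro' hc (isClosed_tsupport v) h0)

theorem continuous_dot_self (hv : ContDiff ℝ (⊤ : ℕ∞) v) :
    Continuous (fun x => dot (v x) (v x)) :=
  ((hv.fst.mul hv.fst).add (hv.snd.mul hv.snd)).continuous

theorem integrable_energyDensity (hh : ContDiff ℝ (⊤ : ℕ∞) h) (hb : ContDiff ℝ (⊤ : ℕ∞) b)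
    (hv : ContDiff ℝ (⊤ : ℕ∞) v) (hc : HasCompactSupport v) :
    Integrable (energyDensity ε μ h b v) := by
  refine integrable_of_eq_zero_off_tsupport hc ?_ fun x hx => ?_
  · have := hh.continuous
    have := continuous_dot_self hv
    have := hv.divg.continuous
    have := hv.curl.continuous
    have := (hb.dot_grad hv).continuous
    unfold energyDensity
    fun_prop
  · simp [energyDensity, divg_eq_zero_of_notMem_tsupport hx, curl_eq_zero_of_notMem_tsupport hx,
      image_eq_zero_of_notMem_tsupport hx, dot]

theorem integral_dot_Tfrak (hh : ContDiff ℝ (⊤ : ℕ∞) h) (hb : ContDiff ℝ (⊤ : ℕ∞) b)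
    (hv : ContDiff ℝ (⊤ : ℕ∞) v) (hc : HasCompactSupport v) :
    ∫ x, dot (Tfrak ε μ h b v x) (v x) = ∫ x, energyDensity ε μ h b v x := by
  have hcF : HasCompactSupport (energyFlux ε μ h b v) :=
    HasCompactSupport.intro' hc (isClosed_tsupport v) fun x hx => by
      simp [energyFlux, image_eq_zero_of_notMem_tsupport hx]
  obtain ⟨hi, h0⟩ := integral_divg_eq_zero (contDiff_energyFlux (ε := ε) (μ := μ) hh hb hv) hcF
  simp_rw [dot_Tfrak_eq hh hb hv]
  rw [integral_add (integrable_energyDensity hh hb hv hc) hi, h0, add_zero]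

end Smooth

theorem cube_mul_sq_div_twelve_le (H D B : ℝ) (hH : 0 ≤ H) :
    H^3 * D^2 / 12 ≤ (1/3) * H^3 * D^2 - H^2 * B * D + H * B^2 := by
  have : 0 ≤ H * (H * D / 2 - B)^2 := by positivity
  nlinarith

theorem X0_density_le_energyDensity {hmin ε μ : ℝ} (hmin_pos : 0 < hmin) (hμ : 0 ≤ μ)
    {h b : ℝ × ℝ → ℝ} {v : ℝ × ℝ → ℝ × ℝ} {x : ℝ × ℝ} (hx : hmin ≤ h x) :
    dot (v x) (v x) + μ * (divg v x)^2 + μ * (curl v x)^2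
      ≤ (1 / hmin + 12 / hmin^3 + 1) * energyDensity ε μ h b v x := by
  have hv0 : 0 ≤ dot (v x) (v x) := add_nonneg (mul_self_nonneg _) (mul_self_nonneg _)
  have hD0 : 0 ≤ μ * (divg v x)^2 := by positivity
  have hc0 : 0 ≤ μ * (curl v x)^2 := by positivity
  have hcube : hmin^3 ≤ (h x)^3 := by gcongr
  have hq := mul_le_mul_of_nonneg_left (cube_mul_sq_div_twelve_le (h x) (divg v x)
    (ε * dot (grad b x) (v x)) (hmin_pos.le.trans hx)) hμ
  have hlow : hmin * dot (v x) (v x) + hmin^3 / 12 * (μ * (divg v x)^2) + μ * (curl v x)^2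
      ≤ energyDensity ε μ h b v x := by
    have hv1 := mul_le_mul_of_nonneg_right hx hv0
    have hD1 := mul_le_mul_of_nonneg_right hcube hD0
    unfold energyDensity
    linarith
  refine le_trans ?_ (mul_le_mul_of_nonneg_left hlow (by positivity))
  have hexp : (1 / hmin + 12 / hmin^3 + 1) * (hmin * dot (v x) (v x)
        + hmin^3 / 12 * (μ * (divg v x)^2) + μ * (curl v x)^2)
      = dot (v x) (v x) + μ * (divg v x)^2 + μ * (curl v x)^2
        + ((12 / hmin^3 + 1) * hmin * dot (v x) (v x)
          + (1 / hmin + 1) * (hmin^3 / 12) * (μ * (divg v x)^2)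
          + (1 / hmin + 12 / hmin^3) * (μ * (curl v x)^2)) := by
    field_simp
    ring
  rw [hexp]
  exact le_add_of_nonneg_right (by positivity)

/-- Lemma 3, `s = 0`, second inequality: the `X⁰`-norm is bounded by the energy
`(v, 𝔗v)`, uniformly in `ε, μ ∈ (0,1]`, under the nonzero-depth condition. -/
theorem X0_norm_le_energy (hmin M : ℝ) (hmin_pos : 0 < hmin) (hM : 1 ≤ M) :
    ∃ C : ℝ, 0 < C ∧
      ∀ (ε μ : ℝ), ε ∈ Set.Ioc (0:ℝ) 1 → μ ∈ Set.Ioc (0:ℝ) 1 →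
      ∀ (h b : ℝ × ℝ → ℝ), ContDiff ℝ (⊤ : ℕ∞) h → ContDiff ℝ (⊤ : ℕ∞) b →
      (∀ x, hmin ≤ h x) →
      (∀ x, dot (grad b x) (grad b x) ≤ M^2) →
      ∀ (v : ℝ × ℝ → ℝ × ℝ), ContDiff ℝ (⊤ : ℕ∞) v → HasCompactSupport v →
      (∫ x : ℝ × ℝ, dot (v x) (v x))
          + μ * (∫ x : ℝ × ℝ, (divg v x)^2)
          + μ * (∫ x : ℝ × ℝ, (curl v x)^2)
        ≤ C * ∫ x : ℝ × ℝ, dot (Tfrak ε μ h b v x) (v x) := by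
  refine ⟨1 / hmin + 12 / hmin^3 + 1, by positivity, ?_⟩
  intro ε μ _ hμ h b hh hb hdepth _ v hv hc
  have hi1 : Integrable (fun x => dot (v x) (v x)) :=
    integrable_of_eq_zero_off_tsupport hc (continuous_dot_self hv) fun x hx => by
      simp [image_eq_zero_of_notMem_tsupport hx, dot]
  have hi2 : Integrable (fun x => μ * (divg v x)^2) :=
    integrable_of_eq_zero_off_tsupport hc (continuous_const.mul (hv.divg.continuous.pow 2))
      fun x hx => by simp [divg_eq_zero_of_notMem_tsupport hx]
  have hi3 : Integrable (fun x => μ * (curl v x)^2) :=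
    integrable_of_eq_zero_off_tsupport hc (continuous_const.mul (hv.curl.continuous.pow 2))
      fun x hx => by simp [curl_eq_zero_of_notMem_tsupport hx]
  have hi12 : Integrable (fun x => dot (v x) (v x) + μ * (divg v x)^2) := hi1.add hi2
  rw [integral_dot_Tfrak hh hb hv hc, ← integral_const_mul, ← integral_const_mul,
    ← integral_const_mul, ← integral_add hi1 hi2, ← integral_add hi12 hi3]
  exact integral_mono (hi12.add hi3)
    ((integrable_energyDensity hh hb hv hc).const_mul _)
    fun x => X0_density_le_energyDensity hmin_pos hμ.1.le (hdepth x)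

end
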